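/- For every positive natural number K and every colouring c assigning to each unordered pair of distinct real numbers a colour in {0,…,K−1}, there is a set of reals Y, homeomorphic to ℚ, such that c takes at most 2 values on unordered pairs of distinct elements of Y, i.e. |c''[Y]²| ≤ 2. -/

import Mathlib

/-- The set of colours taken by the pair-colouring `c` on unordered pairs of
distinct elements of `Y`, i.e. `c''[Y]²`. -/
def pairColours {X : Type*} {K : ℕ} (c : Sym2 X → Fin K) (Y : Set X) : Set (Fin K) :=
  {k | ∃ x ∈ Y, ∃ y ∈ Y, x ≠ y ∧ c s(x, y) = k}

open Set Filter Topology

theorem exists_isClopen_subset_ball {X : Type*} [MetricSpace X] [Countable X] (x : X) {ε : ℝ}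
    (hε : 0 < ε) : ∃ D : Set X, IsClopen D ∧ x ∈ D ∧ D ⊆ Metric.ball x ε := by
  have hc : (range fun z => dist z x).Countable := countable_range _
  obtain ⟨r, hr, hr0, hrε⟩ := (hc.dense_compl ℝ).exists_between hε
  refine ⟨Metric.ball x r, ⟨?_, Metric.isOpen_ball⟩, Metric.mem_ball_self hr0,
    Metric.ball_subset_ball hrε.le⟩
  have : Metric.ball x r = Metric.closedBall x r := by
    ext z
    have hz : dist z x ≠ r := fun h => hr ⟨z, h⟩
    simp only [Metric.mem_ball, Metric.mem_closedBall]
    exact ⟨le_of_lt, fun h => lt_of_le_of_ne h hz⟩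
  rw [this]
  exact Metric.isClosed_closedBall

theorem isOpen_setOf_mem_iff_of_isClopen {X : Type*} [TopologicalSpace X] {C : Set X}
    (hC : IsClopen C) (p : Prop) : IsOpen {z | z ∈ C ↔ p} := by
  by_cases hp : p
  · simpa [hp] using hC.isOpen
  · simp only [hp, iff_false]
    exact hC.compl.isOpen

/-- One step in the construction of the separating sequence of clopen sets: `C` isolates `x` from
some point of the neighbourhood `N` of `x`, on the side prescribed by `b`, and its part
containing `x` is `ε`-small. -/
theorem exists_isClopen_splitting {X : Type*} [MetricSpace X] [Countable X] {x : X}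
    (hx : (𝓝[≠] x).NeBot) (b : Prop) {N : Set X} (hN : N ∈ 𝓝 x) {ε : ℝ} (hε : 0 < ε) :
    ∃ C : Set X, IsClopen C ∧ (x ∈ C ↔ b) ∧ (∃ z ∈ N, z ∈ C ↔ ¬ b) ∧
      ∀ w, (w ∈ C ↔ x ∈ C) → dist w x < ε := by
  obtain ⟨z, hzN, hzx⟩ : ∃ z ∈ N, z ≠ x := by
    obtain ⟨z, hz⟩ := hx.nonempty_of_mem (inter_mem (mem_nhdsWithin_of_mem_nhds hN)
      self_mem_nhdsWithin)
    exact ⟨z, hz.1, hz.2⟩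
  obtain ⟨D, hD, hxD, hDb⟩ := exists_isClopen_subset_ball x (lt_min hε (dist_pos.2 hzx))
  have hzD : z ∉ D := fun h => ((Metric.mem_ball.1 (hDb h)).trans_le (min_le_right _ _)).false
  have hDε : ∀ w ∈ D, dist w x < ε := fun w h => lt_of_lt_of_le (hDb h) (min_le_left _ _)
  by_cases hb : b
  · exact ⟨D, hD, by simp [hxD, hb], ⟨z, hzN, by simp [hzD, hb]⟩, fun w hw => hDε w (hw.2 hxD)⟩
  · refine ⟨Dᶜ, hD.compl, by simp [hxD, hb], ⟨z, hzN, by simp [hzD, hb]⟩, fun w hw => hDε w ?_⟩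
    by_contra h
    exact (hw.1 h) hxD

theorem exists_clopen_sequence {X : Type*} [MetricSpace X] [Countable X] [Nonempty X]
    (hX : ∀ x : X, (𝓝[≠] x).NeBot) :
    ∃ C : ℕ → Set X, (∀ n, IsClopen (C n)) ∧ ∀ (x : X) (b : Bool) (m : ℕ), ∃ n ≥ m,
      (x ∈ C n ↔ b) ∧ (∃ z, (∀ k < n, z ∈ C k ↔ x ∈ C k) ∧ (z ∈ C n ↔ ¬ b)) ∧
      ∀ w, (w ∈ C n ↔ x ∈ C n) → dist w x < 1 / (m + 1) := by
  obtain ⟨e, he⟩ := exists_surjective_nat (X × Bool)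
  have step : ∀ (n : ℕ) (N : {N : X → Set X // ∀ x, N x ∈ 𝓝 x}), ∃ C : Set X, IsClopen C ∧
      ((e n.unpair.1).1 ∈ C ↔ (e n.unpair.1).2) ∧
      (∃ z ∈ N.1 (e n.unpair.1).1, z ∈ C ↔ ¬ (e n.unpair.1).2) ∧
      ∀ w, (w ∈ C ↔ (e n.unpair.1).1 ∈ C) → dist w (e n.unpair.1).1 < 1 / (n + 1) :=
    fun n N => exists_isClopen_splitting (hX _) _ (N.2 _) (by positivity)
  choose F hF using step
  have hnext : ∀ (n : ℕ) (N : {N : X → Set X // ∀ x, N x ∈ 𝓝 x}) (x : X),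
      N.1 x ∩ {z | z ∈ F n N ↔ x ∈ F n N} ∈ 𝓝 x :=
    fun n N x => inter_mem (N.2 x)
      ((isOpen_setOf_mem_iff_of_isClopen (hF n N).1 _).mem_nhds Iff.rfl)
  let N : ℕ → {N : X → Set X // ∀ x, N x ∈ 𝓝 x} := fun n =>
    Nat.rec ⟨fun _ => univ, fun _ => univ_mem⟩
      (fun n N => ⟨fun x => N.1 x ∩ {z | z ∈ F n N ↔ x ∈ F n N}, hnext n N⟩) n
  have hN : ∀ n x z, z ∈ (N n).1 x → ∀ k < n, z ∈ F k (N k) ↔ x ∈ F k (N k) := by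
    intro n x z
    induction n with
    | zero => intro _ k hk; omega
    | succ n ih =>
      intro hz k hk
      rcases Nat.lt_succ_iff_lt_or_eq.1 hk with h | rfl
      · exact ih hz.1 k h
      · exact hz.2
  refine ⟨fun n => F n (N n), fun n => (hF n _).1, fun x b m => ?_⟩
  obtain ⟨i, hi⟩ := he (x, b)
  obtain ⟨-, h1, ⟨z, hz, hz'⟩, h2⟩ := hF (Nat.pair i m) (N (Nat.pair i m))
  have hm : m ≤ Nat.pair i m := Nat.right_le_pair i m
  simp only [Nat.unpair_pair, hi] at h1 hz hz' h2
  refine ⟨_, hm, h1, ⟨z, hN _ _ _ hz, hz'⟩, fun w hw => (h2 w hw).trans_le ?_⟩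
  have : (m : ℝ) ≤ (Nat.pair i m : ℕ) := by exact_mod_cast hm
  gcongr

/-- **Sierpiński's theorem**: a nonempty countable metric space without isolated points is
homeomorphic to `ℚ`. -/
theorem nonempty_homeomorph_rat {X : Type*} [MetricSpace X] [Countable X] [Nonempty X]
    (hX : ∀ x : X, (𝓝[≠] x).NeBot) : Nonempty (X ≃ₜ ℚ) := by
  classical
  obtain ⟨C, hC, hsep⟩ := exists_clopen_sequence hX
  let f : X → Lex (ℕ → Bool) := fun x => toLex fun n => decide (x ∈ C n)
  have agree : ∀ (x : X) {ε : ℝ}, 0 < ε →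
      ∃ n, ∀ w, (∀ k < n, w ∈ C k ↔ x ∈ C k) → dist w x < ε := by
    intro x ε hε
    obtain ⟨m, hm⟩ := exists_nat_one_div_lt hε
    obtain ⟨n, -, -, -, h⟩ := hsep x true m
    exact ⟨n + 1, fun w hw => (h w (hw n n.lt_succ_self)).trans hm⟩
  have hf : Function.Injective f := by
    intro x y hxy
    by_contra hne
    obtain ⟨n, hn⟩ := agree y (dist_pos.2 hne)
    refine (hn x fun k _ => ?_).false
    simpa [f] using congrFun hxy k
  let : LinearOrder X := LinearOrder.lift' f hf
  have lt_iff : ∀ x y : X, x < y ↔ ∃ n, (∀ k < n, x ∈ C k ↔ y ∈ C k) ∧ x ∉ C n ∧ y ∈ C n := by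
    intro x y
    change (∃ n, (∀ k < n, decide (x ∈ C k) = decide (y ∈ C k)) ∧
      decide (x ∈ C n) < decide (y ∈ C n)) ↔ _
    simp [Bool.lt_iff]
  have openAgree : ∀ (x : X) (n : ℕ), IsOpen {z | ∀ k < n, z ∈ C k ↔ x ∈ C k} := by
    intro x n
    have : {z | ∀ k < n, z ∈ C k ↔ x ∈ C k} = ⋂ k ∈ Finset.range n, {z | z ∈ C k ↔ x ∈ C k} := by
      ext; simp
    rw [this]
    exact isOpen_biInter_finset fun k _ => isOpen_setOf_mem_iff_of_isClopen (hC k) _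
  have openGt : ∀ x : X, IsOpen (Ioi x) := by
    intro x
    have : Ioi x = ⋃ n, {z | (∀ k < n, z ∈ C k ↔ x ∈ C k) ∧ x ∉ C n ∧ z ∈ C n} := by
      ext z; simp only [mem_Ioi, lt_iff, mem_iUnion, mem_ofPred_eq, @iff_comm (z ∈ C _)]
    rw [this]
    exact isOpen_iUnion fun n => (openAgree x n).inter (isOpen_const.inter (hC n).isOpen)
  have openLt : ∀ x : X, IsOpen (Iio x) := by
    intro x
    have : Iio x = ⋃ n, {z | (∀ k < n, z ∈ C k ↔ x ∈ C k) ∧ z ∉ C n ∧ x ∈ C n} := by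
      ext z; simp only [mem_Iio, lt_iff, mem_iUnion, mem_ofPred_eq]
    rw [this]
    exact isOpen_iUnion fun n => (openAgree x n).inter ((hC n).compl.isOpen.inter isOpen_const)
  have below : ∀ (x : X) (m : ℕ), ∃ z < x, ∀ k < m, z ∈ C k ↔ x ∈ C k := by
    intro x m
    obtain ⟨n, hn, hx, ⟨z, hz, hzn⟩, -⟩ := hsep x true m
    exact ⟨z, (lt_iff _ _).2 ⟨n, hz, by simpa using hzn, by simpa using hx⟩,
      fun k hk => hz k (hk.trans_le hn)⟩
  have above : ∀ (x : X) (m : ℕ), ∃ z > x, ∀ k < m, z ∈ C k ↔ x ∈ C k := by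
    intro x m
    obtain ⟨n, hn, hx, ⟨z, hz, hzn⟩, -⟩ := hsep x false m
    exact ⟨z, (lt_iff _ _).2 ⟨n, fun k hk => (hz k hk).symm, by simpa using hx, by simpa using hzn⟩,
      fun k hk => hz k (hk.trans_le hn)⟩
  have convex : ∀ (x a b w : X) (m : ℕ), (∀ k < m, a ∈ C k ↔ x ∈ C k) →
      (∀ k < m, b ∈ C k ↔ x ∈ C k) → a < w → w < b → ∀ k < m, w ∈ C k ↔ x ∈ C k := by
    intro x a b w m ha hb haw hwb
    obtain ⟨n, h1, h2, h3⟩ := (lt_iff _ _).1 haw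
    obtain ⟨n', h1', h2', h3'⟩ := (lt_iff _ _).1 hwb
    grind
  have : DenselyOrdered X := by
    refine ⟨fun x y hxy => ?_⟩
    obtain ⟨n, h1, h2, h3⟩ := (lt_iff _ _).1 hxy
    obtain ⟨z, hz, hzx⟩ := above x (n + 1)
    refine ⟨z, hz, (lt_iff _ _).2 ⟨n, fun k hk => (hzx k (by omega)).trans (h1 k hk), ?_, h3⟩⟩
    rwa [hzx n (by omega)]
  have : NoMinOrder X := ⟨fun x => (below x 0).imp fun z hz => hz.1⟩
  have : NoMaxOrder X := ⟨fun x => (above x 0).imp fun z hz => hz.1⟩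
  have : OrderTopology X := by
    refine ⟨le_antisymm ?_ ?_⟩
    · refine le_generateFrom ?_
      rintro s ⟨a, rfl | rfl⟩
      exacts [openGt a, openLt a]
    · refine le_of_nhds_le_nhds fun x => ?_
      rw [Metric.nhds_basis_ball.ge_iff]
      intro ε hε
      obtain ⟨n, hn⟩ := agree x hε
      obtain ⟨a, hax, ha⟩ := below x n
      obtain ⟨b, hxb, hb⟩ := above x n
      let := Preorder.topology X
      have : OrderTopology X := ⟨rfl⟩
      exact mem_of_superset (Ioo_mem_nhds hax hxb) fun w hw =>
        hn w (convex x a b w n ha hb hw.1 hw.2)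
  exact (Order.iso_of_countable_dense X ℚ).map OrderIso.toHomeomorph

theorem isNowhereDense_diff {X : Type*} [TopologicalSpace X] {W G : Set X} (hW : IsOpen W)
    (h : ∀ O ⊆ W, IsOpen O → O.Nonempty → ∃ V ⊆ O, IsOpen V ∧ V.Nonempty ∧ V ⊆ G) :
    IsNowhereDense (W \ G) := by
  rw [IsNowhereDense, eq_empty_iff_forall_notMem]
  intro x hx
  obtain ⟨y, hy, hyW, -⟩ :=
    mem_closure_iff.1 (interior_subset hx) _ isOpen_interior hx
  obtain ⟨V, hV, hVo, ⟨z, hz⟩, hVG⟩ := h (interior (closure (W \ G)) ∩ W) inter_subset_right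
    (isOpen_interior.inter hW) ⟨y, hy, hyW⟩
  obtain ⟨w, hwV, -, hwG⟩ := mem_closure_iff.1 (interior_subset (hV hz).1) V hVo hz
  exact hwG (hVG hwV)

/-- `A` is nonmeagre in every nonempty open subset of `U`. -/
def EverywhereNonmeagre {X : Type*} [TopologicalSpace X] (A U : Set X) : Prop :=
  ∀ V ⊆ U, IsOpen V → V.Nonempty → ¬ IsMeagre (A ∩ V)

theorem EverywhereNonmeagre.mono_right {X : Type*} [TopologicalSpace X] {A U U' : Set X}
    (h : EverywhereNonmeagre A U) (hU : U' ⊆ U) : EverywhereNonmeagre A U' :=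
  fun V hV => h V (hV.trans hU)

/-- A form of the **Banach category theorem**. -/
theorem exists_everywhereNonmeagre {X : Type*} [TopologicalSpace X] [SecondCountableTopology X]
    {A W : Set X} (hW : IsOpen W) (h : ¬ IsMeagre (A ∩ W)) :
    ∃ U ⊆ W, IsOpen U ∧ U.Nonempty ∧ EverywhereNonmeagre A U := by
  by_contra! hcon
  simp only [EverywhereNonmeagre] at hcon
  push Not at hcon
  let S : Set (Set X) := {b ∈ TopologicalSpace.countableBasis X | IsMeagre (A ∩ b)}
  have hS : S.Countable := (TopologicalSpace.countable_countableBasis X).mono (sep_subset _ _)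
  have : Countable S := hS
  have h1 : IsMeagre (⋃ b : S, A ∩ b) := isMeagre_iUnion fun b => b.2.2
  have h2 : IsNowhereDense (W \ ⋃₀ S) := by
    refine isNowhereDense_diff hW fun O hO hOo hOn => ?_
    obtain ⟨V, hVO, hVo, ⟨x, hx⟩, hV⟩ := hcon O hO hOo hOn
    obtain ⟨b, hb, hxb, hbV⟩ :=
      (TopologicalSpace.isBasis_countableBasis X).exists_subset_of_mem_open hx hVo
    exact ⟨b, hbV.trans hVO, (TopologicalSpace.isBasis_countableBasis X).isOpen hb, ⟨x, hxb⟩,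
      subset_sUnion_of_mem ⟨hb, hV.mono (inter_subset_inter_right A hbV)⟩⟩
  refine h ((h1.union h2.isMeagre).mono fun x hx => ?_)
  by_cases hxS : x ∈ ⋃₀ S
  · obtain ⟨b, hb, hxb⟩ := hxS
    exact Or.inl (mem_iUnion.2 ⟨⟨b, hb⟩, hx.1, hxb⟩)
  · exact Or.inr ⟨hx.2, hxS⟩

/-- The points joined to `x` by a pair whose colour lies in `P`. -/
def link {X κ : Type*} (c : Sym2 X → κ) (x : X) (P : Set κ) : Set X :=
  {y | y ≠ x ∧ c s(x, y) ∈ P}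

/-- For every nonmeagre `B' ⊆ B`, almost all points of `A` are joined to nonmeagrely many points
of `B'` by colours from `P`. -/
def Linked {X κ : Type*} [TopologicalSpace X] (c : Sym2 X → κ) (P : Set κ) (A B : Set X) : Prop :=
  ∀ B' ⊆ B, ¬ IsMeagre B' → IsMeagre {x ∈ A | IsMeagre (B' ∩ link c x P)}

theorem link_mono {X κ : Type*} (c : Sym2 X → κ) (x : X) {P Q : Set κ} (h : P ⊆ Q) :
    link c x P ⊆ link c x Q :=
  fun _ hy => ⟨hy.1, h hy.2⟩

theorem Linked.mono {X κ : Type*} [TopologicalSpace X] {c : Sym2 X → κ} {P Q : Set κ}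
    {A A' B B' : Set X} (h : Linked c P A B) (hP : P ⊆ Q) (hA : A' ⊆ A) (hB : B' ⊆ B) : Linked c Q A' B' := by
  intro C hC hCn
  refine (h C (hC.trans hB) hCn).mono ?_
  rintro x ⟨hx, hxC⟩
  exact ⟨hA hx, hxC.mono (inter_subset_inter_right _ (link_mono c x hP))⟩

/-- `A` and `B` are linked in both directions, by the colours `t.1` and `t.2`. -/
def BiLinked {X κ : Type*} [TopologicalSpace X] (c : Sym2 X → κ) (t : κ × κ) (A B : Set X) : Prop :=
  Linked c {t.1} A B ∧ Linked c {t.2} B A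

theorem BiLinked.mono {X κ : Type*} [TopologicalSpace X] {c : Sym2 X → κ} {t : κ × κ}
    {A A' B B' : Set X} (h : BiLinked c t A B) (hA : A' ⊆ A) (hB : B' ⊆ B) : BiLinked c t A' B' :=
  ⟨h.1.mono Subset.rfl hA hB, h.2.mono Subset.rfl hB hA⟩

theorem isMeagre_singleton_real (x : ℝ) : IsMeagre ({x} : Set ℝ) := by
  refine IsNowhereDense.isMeagre ?_
  simp [IsNowhereDense]

theorem exists_linked_of_finset {κ : Type*} [Finite κ] (c : Sym2 ℝ → κ) (S : Finset κ) :
    ∀ {A B : Set ℝ}, ¬ IsMeagre A → ¬ IsMeagre B →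
      (∀ x ∈ A, ∀ k, ¬ IsMeagre (B ∩ link c x {k}) → k ∈ S) →
      ∃ i, ∃ A' ⊆ A, ∃ B' ⊆ B, ¬ IsMeagre A' ∧ ¬ IsMeagre B' ∧ Linked c {i} A' B' := by
  classical
  induction S using Finset.strongInduction with
  | H S ih =>
    intro A B hA hB hS
    obtain ⟨x, hx⟩ := nonempty_of_not_isMeagre hA
    obtain ⟨i, hi⟩ : ∃ i, ¬ IsMeagre (B ∩ link c x {i}) := by
      by_contra! hcon
      refine hB (((isMeagre_singleton_real x).union (isMeagre_iUnion hcon)).mono fun y hy => ?_)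
      by_cases hyx : y = x
      · exact Or.inl hyx
      · exact Or.inr (mem_iUnion.2 ⟨c s(x, y), hy, hyx, rfl⟩)
    by_cases hL : Linked c {i} A B
    · exact ⟨i, A, Subset.rfl, B, Subset.rfl, hA, hB, hL⟩
    · simp only [Linked] at hL
      push Not at hL
      obtain ⟨B', hB'B, hB', hA'⟩ := hL
      obtain ⟨j, A'', hA'', B'', hB'', h⟩ := ih (S.erase i) (Finset.erase_ssubset (hS x hx i hi))
        hA' hB' fun y hy k hk => by
          refine Finset.mem_erase.2 ⟨?_, hS y hy.1 k fun h =>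
            hk (h.mono (inter_subset_inter_left _ hB'B))⟩
          rintro rfl
          exact hk hy.2
      exact ⟨j, A'', hA''.trans (sep_subset _ _), B'', hB''.trans hB'B, h⟩

theorem exists_biLinked {κ : Type*} [Finite κ] (c : Sym2 ℝ → κ) {A B : Set ℝ}
    (hA : ¬ IsMeagre A) (hB : ¬ IsMeagre B) :
    ∃ t, ∃ A' ⊆ A, ∃ B' ⊆ B, ¬ IsMeagre A' ∧ ¬ IsMeagre B' ∧ BiLinked c t A' B' := by
  have := Fintype.ofFinite κ
  obtain ⟨i, A₁, hA₁, B₁, hB₁, hA₁n, hB₁n, h₁⟩ :=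
    exists_linked_of_finset c Finset.univ hA hB fun _ _ _ _ => Finset.mem_univ _
  obtain ⟨j, B₂, hB₂, A₂, hA₂, hB₂n, hA₂n, h₂⟩ :=
    exists_linked_of_finset c Finset.univ hB₁n hA₁n fun _ _ _ _ => Finset.mem_univ _
  exact ⟨(i, j), A₂, hA₂.trans hA₁, B₂, hB₂.trans hB₁, hA₂n, hB₂n,
    h₁.mono Subset.rfl hA₂ hB₂, h₂⟩

/-- The pairs of colours by which some `A' ⊆ A` that is everywhere nonmeagre in `U` is linked
to `B`. -/
def linkTypes {X κ : Type*} [TopologicalSpace X] (c : Sym2 X → κ) (U A B : Set X) : Set (κ × κ) :=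
  {t | ∃ A' ⊆ A, EverywhereNonmeagre A' U ∧ BiLinked c t A' B}

theorem linkTypes_mono {X κ : Type*} [TopologicalSpace X] (c : Sym2 X → κ)
    {U U' A A' B B' : Set X} (hU : U' ⊆ U) (hA : A ⊆ A') (hB : B' ⊆ B) :
    linkTypes c U A B ⊆ linkTypes c U' A' B' := by
  rintro t ⟨D, hD, hDU, hDB⟩
  exact ⟨D, hD.trans hA, hDU.mono_right hU, hDB.mono Subset.rfl hB⟩

/-- Below any condition `(A, U)` under `(A₀, U₀)` there are `U'` and `B` for which the set of
link types is as large as `A₀` allows, in a hereditary way. -/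
def StableLinkTypes {X κ : Type*} [TopologicalSpace X] (c : Sym2 X → κ) (A₀ U₀ : Set X) : Prop :=
  ∀ A ⊆ A₀, ∀ U ⊆ U₀, IsOpen U → U.Nonempty → EverywhereNonmeagre A U →
    ∃ U' ⊆ U, ∃ B ⊆ A ∩ U, IsOpen U' ∧ U'.Nonempty ∧ ¬ IsMeagre B ∧
      ∀ U'' ⊆ U', ∀ B'' ⊆ B, IsOpen U'' → U''.Nonempty → ¬ IsMeagre B'' →
        linkTypes c U'' A₀ B'' = linkTypes c U' A B

theorem exists_stableLinkTypes {κ : Type*} [Finite κ] (c : Sym2 ℝ → κ) :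
    ∃ A₀ U₀ : Set ℝ, IsOpen U₀ ∧ U₀.Nonempty ∧ EverywhereNonmeagre A₀ U₀ ∧
      StableLinkTypes c A₀ U₀ := by
  classical
  let Bdd : ℕ → Prop := fun n => ∃ A U : Set ℝ, IsOpen U ∧ U.Nonempty ∧ EverywhereNonmeagre A U ∧
    ∀ U' ⊆ U, ∀ B ⊆ A ∩ U, IsOpen U' → U'.Nonempty → ¬ IsMeagre B → (linkTypes c U' A B).ncard ≤ n
  have hex : ∃ n, Bdd n := by
    refine ⟨Nat.card (κ × κ), univ, univ, isOpen_univ, univ_nonempty, fun V _ hV hVn => ?_,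
      fun _ _ _ _ _ _ _ => ?_⟩
    · rw [univ_inter]
      exact not_isMeagre_of_isOpen hV hVn
    · rw [← ncard_univ]
      exact ncard_le_ncard (subset_univ _)
  obtain ⟨A₀, U₀, hU₀, hU₀n, hA₀, hmax⟩ := Nat.find_spec hex
  refine ⟨A₀, U₀, hU₀, hU₀n, hA₀, fun A hA U hU hUo hUn hAU => ?_⟩
  obtain ⟨U', hU', B, hB, hU'o, hU'n, hBn, hcard⟩ : ∃ U' ⊆ U, ∃ B ⊆ A ∩ U, IsOpen U' ∧
      U'.Nonempty ∧ ¬ IsMeagre B ∧ Nat.find hex ≤ (linkTypes c U' A B).ncard := by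
    by_contra! hcon
    have hpos := hcon U Subset.rfl _ Subset.rfl hUo hUn (hAU U Subset.rfl hUo hUn)
    refine Nat.find_min hex (m := Nat.find hex - 1) (by omega) ⟨A, U, hUo, hUn, hAU, ?_⟩
    intro U' hU' B hB hU'o hU'n hBn
    have := hcon U' hU' B hB hU'o hU'n hBn
    omega
  refine ⟨U', hU', B, hB, hU'o, hU'n, hBn, fun U'' hU'' B'' hB'' hU''o hU''n hB''n => ?_⟩
  refine (eq_of_subset_of_ncard_le (linkTypes_mono c hU'' hA hB'') ?_).symm
  exact (hmax U'' (hU''.trans (hU'.trans hU)) B''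
    (hB''.trans (hB.trans (inter_subset_inter hA hU))) hU''o hU''n hB''n).trans hcard

theorem isMeagre_setOf_forall_linkTypes {κ : Type*} [Finite κ] (c : Sym2 ℝ → κ)
    {A₀ U B : Set ℝ} {T : Set (κ × κ)} (hU : IsOpen U) (hB : ¬ IsMeagre B)
    (hT : ∀ U' ⊆ U, ∀ B' ⊆ B, IsOpen U' → U'.Nonempty → ¬ IsMeagre B' →
      linkTypes c U' A₀ B' = T) :
    IsMeagre {x ∈ A₀ ∩ U | ∀ t ∈ T, IsMeagre (B ∩ link c x {t.1})} := by
  by_contra hN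
  obtain ⟨t, N', hN', B', hB', hN'n, hB'n, hL⟩ := exists_biLinked c hN hB
  have hN'U : N' ⊆ U := fun x hx => (hN' hx).1.2
  obtain ⟨U', hU', hU'o, hU'n, hE⟩ := exists_everywhereNonmeagre hU
    (by rwa [inter_eq_left.2 hN'U])
  have ht : t ∈ T := by
    rw [← hT U' hU' B' hB' hU'o hU'n hB'n]
    exact ⟨N', fun x hx => (hN' hx).1.1, hE, hL⟩
  refine hN'n ((hL.1 B' Subset.rfl hB'n).mono ?_)
  intro x hx
  exact ⟨hx, ((hN' hx).2 t ht).mono (inter_subset_inter_left _ hB')⟩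

theorem exists_seq_of_step {α : Type*} {I : ℕ → α → Prop} {R : ℕ → α → α → Prop}
    (h₀ : ∃ a, I 0 a) (h : ∀ n a, I n a → ∃ a', I (n + 1) a' ∧ R n a a') :
    ∃ f : ℕ → α, (∀ n, I n (f n)) ∧ ∀ n, R n (f n) (f (n + 1)) := by
  obtain ⟨a₀, h₀⟩ := h₀
  choose F hF using fun n (a : {a // I n a}) => h n a a.2
  let f : ∀ n, {a // I n a} := fun n => Nat.rec ⟨a₀, h₀⟩ (fun n a => ⟨F n a, (hF n a).1⟩) n
  exact ⟨fun n => (f n).1, fun n => (f n).2, fun n => (hF n (f n)).2⟩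

theorem isMeagre_setOf_not_exists_biLinked_seq {κ : Type*} [Finite κ] (c : Sym2 ℝ → κ)
    {A₀ U₀ A₁ U₁ : Set ℝ} (hst : StableLinkTypes c A₀ U₀) (hA : A₁ ⊆ A₀) (hU : U₁ ⊆ U₀)
    (hU₁ : IsOpen U₁) (hU₁n : U₁.Nonempty) (hE : EverywhereNonmeagre A₁ U₁) :
    IsMeagre {x ∈ A₀ ∩ U₁ | ¬ ∃ (t : ℕ → κ × κ) (S : ℕ → Set ℝ),
      (∀ n, S n ⊆ A₁ ∧ ¬ IsMeagre (S n) ∧ S n ⊆ Metric.ball x (1 / (n + 1)) ∧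
        S n ⊆ link c x {(t n).1}) ∧ ∀ m n, m < n → BiLinked c (t m) (S n) (S m)} := by
  classical
  let Cond := {p : Set ℝ × Set ℝ // p.1 ⊆ A₁ ∧ p.2 ⊆ U₀ ∧ IsOpen p.2 ∧ p.2.Nonempty ∧
    EverywhereNonmeagre p.1 p.2}
  let 𝓑 := TopologicalSpace.countableBasis ℝ
  have h𝓑 := TopologicalSpace.isBasis_countableBasis ℝ
  have step : ∀ (p : Cond) (V : 𝓑), ∃ (U' B : Set ℝ) (T : Set (κ × κ)) (q : κ × κ → Cond),
      V.1 ⊆ p.1.2 → U' ⊆ V ∧ IsOpen U' ∧ U'.Nonempty ∧ B ⊆ p.1.1 ∩ V ∧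
        (∀ t ∈ T, (q t).1.1 ⊆ p.1.1 ∧ (q t).1.2 = U' ∧ BiLinked c t (q t).1.1 B) ∧
        IsMeagre {x ∈ A₀ ∩ U' | ∀ t ∈ T, IsMeagre (B ∩ link c x {t.1})} := by
    intro p V
    by_cases hV : V.1 ⊆ p.1.2
    · obtain ⟨hpA, hpU, -, -, hpE⟩ := p.2
      obtain ⟨U', hU', B, hB, hU'o, hU'n, hBn, hmax⟩ := hst p.1.1 (hpA.trans hA) V
        (hV.trans hpU) (h𝓑.isOpen V.2) (TopologicalSpace.nonempty_of_mem_countableBasis V.2)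
        (hpE.mono_right hV)
      have hq : ∀ t : κ × κ, ∃ q : Cond, t ∈ linkTypes c U' p.1.1 B →
          q.1.1 ⊆ p.1.1 ∧ q.1.2 = U' ∧ BiLinked c t q.1.1 B := by
        intro t
        by_cases ht : t ∈ linkTypes c U' p.1.1 B
        · obtain ⟨A', hA', hA'E, hL⟩ := ht
          exact ⟨⟨(A', U'), hA'.trans hpA, hU'.trans (hV.trans hpU), hU'o, hU'n, hA'E⟩,
            fun _ => ⟨hA', rfl, hL⟩⟩
        · exact ⟨p, fun h => absurd h ht⟩
      choose q hq using hq
      exact ⟨U', B, _, q, fun _ => ⟨hU', hU'o, hU'n, hB, hq,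
        isMeagre_setOf_forall_linkTypes c hU'o hBn hmax⟩⟩
    · exact ⟨∅, ∅, ∅, fun _ => p, fun h => absurd h hV⟩
  choose U' B T q hstep using step
  let g : List (𝓑 × (κ × κ)) → Cond :=
    List.foldr (fun a p => q p a.1 a.2) ⟨(A₁, U₁), Subset.rfl, hU, hU₁, hU₁n, hE⟩
  have : Countable 𝓑 := (TopologicalSpace.countable_countableBasis ℝ).to_subtype
  let G : Cond → ℕ → Set ℝ := fun p n =>
    {x | ∃ V : 𝓑, V.1 ⊆ p.1.2 ∧ V.1 ⊆ Metric.ball x (1 / (n + 1)) ∧ x ∈ U' p V}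
  have hG : ∀ p n, IsMeagre (p.1.2 \ G p n) := by
    intro p n
    refine (isNowhereDense_diff p.2.2.2.1 fun O hO hOo ⟨x, hx⟩ => ?_).isMeagre
    have hε : (0 : ℝ) < 1 / (n + 1) := by positivity
    obtain ⟨V, hV, hxV, hVO⟩ := h𝓑.exists_subset_of_mem_open
      (show x ∈ O ∩ Metric.ball x ((1 / (n + 1)) / 2) from
        ⟨hx, Metric.mem_ball_self (half_pos hε)⟩) (hOo.inter Metric.isOpen_ball)
    have hVp : V ⊆ p.1.2 := fun y hy => hO (hVO hy).1
    obtain ⟨h1, h2, h3, -⟩ := hstep p ⟨V, hV⟩ hVp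
    refine ⟨U' p ⟨V, hV⟩, fun y hy => (hVO (h1 hy)).1, h2, h3, fun y hy => ⟨⟨V, hV⟩, hVp, ?_, hy⟩⟩
    intro z hz
    have hy' := Metric.mem_ball.1 (hVO (h1 hy)).2
    have hz' := Metric.mem_ball.1 (hVO hz).2
    exact Metric.mem_ball.2 ((dist_triangle_right z y x).trans_lt (by linarith))
  let E : Cond → 𝓑 → Set ℝ := fun p V =>
    {x | V.1 ⊆ p.1.2 ∧ x ∈ A₀ ∩ U' p V ∧ ∀ t ∈ T p V, IsMeagre (B p V ∩ link c x {t.1})}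
  have hE' : ∀ p V, IsMeagre (E p V) := by
    intro p V
    by_cases hV : V.1 ⊆ p.1.2
    · obtain ⟨-, -, -, -, -, h⟩ := hstep p V hV
      exact h.mono fun x hx => hx.2
    · exact IsMeagre.empty.mono fun x hx => hV hx.1
  refine ((isMeagre_iUnion fun l => isMeagre_iUnion fun n => hG (g l) n).union
    (isMeagre_iUnion fun l => isMeagre_iUnion fun V => hE' (g l) V)).mono ?_
  rintro x ⟨⟨hxA, hxU⟩, hx⟩
  by_contra hcon
  simp only [mem_union, mem_iUnion, not_or, not_exists] at hcon
  refine hx ?_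
  have extend : ∀ (n : ℕ) (p : Cond), ((∃ l, g l = p) ∧ x ∈ p.1.2) →
      ∃ p' : Cond, ((∃ l, g l = p') ∧ x ∈ p'.1.2) ∧ ∃ (t : κ × κ) (S : Set ℝ),
        S ⊆ p.1.1 ∧ p'.1.1 ⊆ p.1.1 ∧ ¬ IsMeagre S ∧ S ⊆ Metric.ball x (1 / (n + 1)) ∧
        S ⊆ link c x {t.1} ∧ BiLinked c t p'.1.1 S := by
    rintro n p ⟨⟨l, rfl⟩, hxp⟩
    obtain ⟨V, hVp, hVx, hxV⟩ : x ∈ G (g l) n := by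
      by_contra h
      exact hcon.1 l n ⟨hxp, h⟩
    obtain ⟨t, ht, hBt⟩ : ∃ t ∈ T (g l) V, ¬ IsMeagre (B (g l) V ∩ link c x {t.1}) := by
      by_contra! h
      exact hcon.2 l V ⟨hVp, ⟨hxA, hxV⟩, h⟩
    obtain ⟨-, -, -, hB, hT, -⟩ := hstep (g l) V hVp
    obtain ⟨hq1, hq2, hq3⟩ := hT t ht
    exact ⟨q (g l) V t, ⟨⟨(V, t) :: l, rfl⟩, by rwa [hq2]⟩, t, B (g l) V ∩ link c x {t.1},
      fun y hy => (hB hy.1).1, hq1, hBt, fun y hy => hVx (hB hy.1).2, inter_subset_right,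
      hq3.mono Subset.rfl inter_subset_left⟩
  obtain ⟨p, -, hp⟩ := exists_seq_of_step ⟨g [], ⟨[], rfl⟩, hxU⟩ extend
  choose t S hS using hp
  have hanti : Antitone fun n => (p n).1.1 := antitone_nat_of_succ_le fun n => (hS n).2.1
  refine ⟨t, S, fun n => ?_, fun m n hmn => ?_⟩
  · obtain ⟨h1, -, h2, h3, h4, -⟩ := hS n
    exact ⟨h1.trans (p n).2.1, h2, h3, h4⟩
  · exact (hS m).2.2.2.2.2.mono ((hS n).1.trans (hanti hmn)) Subset.rfl

/-- `A` contains nonmeagre sets converging to `x`, joined to `x` and linked to one another by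
colours from `P`. -/
def IsFanPoint {κ : Type*} (c : Sym2 ℝ → κ) (P : Set κ) (A : Set ℝ) (x : ℝ) : Prop :=
  ∃ S : ℕ → Set ℝ, (∀ n, S n ⊆ A ∧ ¬ IsMeagre (S n) ∧ S n ⊆ Metric.ball x (1 / (n + 1)) ∧
    S n ⊆ link c x P) ∧ ∀ m n, m ≠ n → Linked c P (S m) (S n)

theorem IsFanPoint.mono {κ : Type*} {c : Sym2 ℝ → κ} {P : Set κ} {A A' : Set ℝ} {x : ℝ}
    (h : IsFanPoint c P A x) (hA : A ⊆ A') : IsFanPoint c P A' x := by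
  obtain ⟨S, hS, hS'⟩ := h
  exact ⟨S, fun n => ⟨(hS n).1.trans hA, (hS n).2⟩, hS'⟩

theorem exists_isFanPoint_of_biLinked_seq {κ : Type*} [Finite κ] {c : Sym2 ℝ → κ} {A : Set ℝ}
    {x : ℝ} {t : ℕ → κ × κ} {S : ℕ → Set ℝ}
    (hS : ∀ n, S n ⊆ A ∧ ¬ IsMeagre (S n) ∧ S n ⊆ Metric.ball x (1 / (n + 1)) ∧
      S n ⊆ link c x {(t n).1})
    (hL : ∀ m n, m < n → BiLinked c (t m) (S n) (S m)) :
    ∃ s : κ × κ, IsFanPoint c {s.1, s.2} A x := by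
  obtain ⟨s, hs⟩ := Finite.exists_infinite_fiber t
  have hinf : {n | t n = s}.Infinite := infinite_coe_iff.1 hs
  refine ⟨s, fun n => S (Nat.nth (fun k => t k = s) n), fun n => ?_, ?_⟩
  · obtain ⟨h1, h2, h3, h4⟩ := hS (Nat.nth (fun k => t k = s) n)
    rw [Nat.nth_mem_of_infinite hinf n] at h4
    have hle : (n : ℝ) ≤ Nat.nth (fun k => t k = s) n := by
      exact_mod_cast (Nat.nth_strictMono hinf).le_apply
    refine ⟨h1, h2, h3.trans (Metric.ball_subset_ball ?_), h4.trans (link_mono c x (by simp))⟩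
    gcongr
  · intro m n hmn
    rcases hmn.lt_or_gt with h | h
    · have := hL _ _ (Nat.nth_strictMono hinf h)
      rw [Nat.nth_mem_of_infinite hinf m] at this
      exact this.2.mono (by simp) Subset.rfl Subset.rfl
    · have := hL _ _ (Nat.nth_strictMono hinf h)
      rw [Nat.nth_mem_of_infinite hinf n] at this
      exact this.1.mono (by simp) Subset.rfl Subset.rfl

theorem exists_forall_not_isMeagre_setOf_isFanPoint {κ : Type*} [Finite κ] (c : Sym2 ℝ → κ) :
    ∃ (s : κ × κ) (A : Set ℝ), ¬ IsMeagre A ∧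
      ∀ B ⊆ A, ¬ IsMeagre B → ¬ IsMeagre {x ∈ B | IsFanPoint c {s.1, s.2} B x} := by
  classical
  have := Fintype.ofFinite κ
  obtain ⟨A₀, U₀, hU₀, hU₀n, hE, hst⟩ := exists_stableLinkTypes c
  by_contra! hcon
  have shrink : ∀ F : Finset (κ × κ), ∃ B ⊆ A₀ ∩ U₀, ¬ IsMeagre B ∧
      ∀ s ∈ F, IsMeagre {x ∈ B | IsFanPoint c {s.1, s.2} B x} := by
    intro F
    induction F using Finset.induction_on with
    | empty => exact ⟨_, Subset.rfl, hE U₀ Subset.rfl hU₀ hU₀n, by simp⟩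
    | insert s F _ ih =>
      obtain ⟨B, hB, hBn, hBF⟩ := ih
      obtain ⟨B', hB', hB'n, hB's⟩ := hcon s B hBn
      refine ⟨B', hB'.trans hB, hB'n, fun r hr => ?_⟩
      rcases Finset.mem_insert.1 hr with rfl | hr
      · exact hB's
      · refine (hBF r hr).mono ?_
        rintro x ⟨hx, hxF⟩
        exact ⟨hB' hx, hxF.mono hB'⟩
  obtain ⟨B, hB, hBn, hBF⟩ := shrink Finset.univ
  obtain ⟨U₁, hU₁, hU₁o, hU₁n, hE₁⟩ := exists_everywhereNonmeagre hU₀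
    (show ¬ IsMeagre (B ∩ U₀) by rwa [inter_eq_left.2 fun x hx => (hB hx).2])
  have hmeagre := isMeagre_setOf_not_exists_biLinked_seq c hst (fun x hx => (hB hx).1) hU₁ hU₁o
    hU₁n hE₁
  refine hE₁ U₁ Subset.rfl hU₁o hU₁n
    ((hmeagre.union (isMeagre_iUnion fun s => hBF s (Finset.mem_univ s))).mono ?_)
  rintro x ⟨hxB, hxU⟩
  by_cases hx : ∃ s : κ × κ, IsFanPoint c {s.1, s.2} B x
  · obtain ⟨s, hs⟩ := hx
    exact Or.inr (mem_iUnion.2 ⟨s, hxB, hs⟩)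
  · refine Or.inl ⟨⟨(hB hxB).1, hxU⟩, ?_⟩
    rintro ⟨t, S, hS, hL⟩
    exact hx (exists_isFanPoint_of_biLinked_seq hS hL)

theorem exists_seq_link {κ : Type*} (c : Sym2 ℝ → κ) (P : Set κ) {A : Set ℝ} (hA : ¬ IsMeagre A)
    (hfan : ∀ B ⊆ A, ¬ IsMeagre B → ¬ IsMeagre {x ∈ B | IsFanPoint c P B x}) :
    ∃ y : ℕ → ℝ, (∀ m n, m < n → y n ∈ link c (y m) P) ∧
      ∀ a, ∀ ε > 0, ∃ n, y n ≠ y a ∧ dist (y n) (y a) < ε := by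
  let I : ℕ → ℝ × (ℕ → ℕ → Set ℝ) → Prop := fun s p =>
    (∀ a ≤ s, ∀ n ≥ s, ¬ IsMeagre (p.2 a n) ∧ p.2 a n ⊆ A ∧ p.2 a n ⊆ link c p.1 P) ∧
    (∀ n ≥ s, p.2 s n ⊆ Metric.ball p.1 (1 / (n + 1))) ∧
    ∀ a ≤ s, ∀ n ≥ s, ∀ a' ≤ s, ∀ n' ≥ s, (a, n) ≠ (a', n') → Linked c P (p.2 a n) (p.2 a' n')
  let R : ℕ → ℝ × (ℕ → ℕ → Set ℝ) → ℝ × (ℕ → ℕ → Set ℝ) → Prop := fun s p q =>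
    q.1 ∈ p.2 s.unpair.1 s ∧ (∀ a ≤ s, ∀ n, q.2 a n ⊆ p.2 a n) ∧
      ∀ n, q.2 (s + 1) n ⊆ p.2 s.unpair.1 s
  have hstart : ∃ p, I 0 p := by
    obtain ⟨x, hxA, S, hS, hL⟩ := nonempty_of_not_isMeagre (hfan A Subset.rfl hA)
    refine ⟨(x, fun _ => S), fun a _ n _ => ⟨(hS n).2.1, (hS n).1, (hS n).2.2.2⟩,
      fun n _ => (hS n).2.2.1, fun a ha n _ a' ha' n' _ hne => hL n n' ?_⟩
    rintro rfl
    exact hne (by simp only [Nat.le_zero.1 ha, Nat.le_zero.1 ha'])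
  have hstep : ∀ s p, I s p → ∃ q, I (s + 1) q ∧ R s p q := by
    rintro s ⟨x, B⟩ ⟨hB, -, hL⟩
    simp only at hB hL
    have hs : s.unpair.1 ≤ s := Nat.unpair_left_le s
    set D := B s.unpair.1 s
    obtain ⟨hDn, hDA, -⟩ := hB _ hs s le_rfl
    have hbad : IsMeagre (⋃ (a : Iic s) (n : Ici (s + 1)),
        {z ∈ D | IsMeagre (B a n ∩ link c z P)}) := by
      refine isMeagre_iUnion fun a => isMeagre_iUnion fun n => ?_
      have hn : s + 1 ≤ n.1 := n.2
      refine hL _ hs s le_rfl a a.2 n (by omega) ?_ _ Subset.rfl (hB a a.2 n (by omega)).1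
      intro h
      have := congrArg Prod.snd h
      simp only at this
      omega
    obtain ⟨z, ⟨hzD, S, hS, hSL⟩, hz⟩ : ∃ z ∈ {z ∈ D | IsFanPoint c P D z},
        z ∉ ⋃ (a : Iic s) (n : Ici (s + 1)), {z ∈ D | IsMeagre (B a n ∩ link c z P)} := by
      by_contra! h
      exact hfan D hDA hDn (hbad.mono h)
    have hz' : ∀ a ≤ s, ∀ n ≥ s + 1, ¬ IsMeagre (B a n ∩ link c z P) := fun a ha n hn h =>
      hz (mem_iUnion.2 ⟨⟨a, ha⟩, mem_iUnion.2 ⟨⟨n, hn⟩, hzD, h⟩⟩)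
    let B' : ℕ → ℕ → Set ℝ := fun a n => if a = s + 1 then S n else B a n ∩ link c z P
    have hB'old : ∀ a ≤ s, ∀ n, B' a n = B a n ∩ link c z P := fun a ha n =>
      if_neg (by omega)
    have hB'new : ∀ n, B' (s + 1) n = S n := fun n => if_pos rfl
    refine ⟨(z, B'), ⟨?_, ?_, ?_⟩, hzD, fun a ha n => ?_, fun n => ?_⟩
    · intro a ha n hn
      rcases Nat.le_succ_iff.1 ha with ha | rfl
      · simp only [hB'old a ha]
        exact ⟨hz' a ha n hn, inter_subset_left.trans (hB a ha n (by omega)).2.1,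
          inter_subset_right⟩
      · simp only [hB'new]
        exact ⟨(hS n).2.1, (hS n).1.trans hDA, (hS n).2.2.2⟩
    · intro n _
      simp only [hB'new]
      exact (hS n).2.2.1
    · intro a ha n hn a' ha' n' hn' hne
      rcases Nat.le_succ_iff.1 ha with ha | rfl <;> rcases Nat.le_succ_iff.1 ha' with ha' | rfl
      · simp only [hB'old a ha, hB'old a' ha']
        exact (hL a ha n (by omega) a' ha' n' (by omega) hne).mono Subset.rfl inter_subset_left
          inter_subset_left
      · simp only [hB'old a ha, hB'new]
        refine (hL a ha n (by omega) _ hs s le_rfl fun h => ?_).mono Subset.rfl inter_subset_left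
          (hS n').1
        have := (Prod.mk.inj h).2
        omega
      · simp only [hB'old a' ha', hB'new]
        refine (hL _ hs s le_rfl a' ha' n' (by omega) fun h => ?_).mono Subset.rfl (hS n).1
          inter_subset_left
        have := (Prod.mk.inj h).2
        omega
      · simp only [hB'new]
        exact hSL n n' fun h => hne (by rw [h])
    · simp only [hB'old a ha]
      exact inter_subset_left
    · simp only [hB'new]
      exact (hS n).1
  obtain ⟨p, hI, hR⟩ := exists_seq_of_step hstart hstep
  have hmono : ∀ s r, s ≤ r → ∀ a ≤ s, ∀ n, (p r).2 a n ⊆ (p s).2 a n := by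
    intro s r hsr
    induction r, hsr using Nat.le_induction with
    | base => exact fun a _ n => Subset.rfl
    | succ r hsr ih => exact fun a ha n => ((hR r).2.1 a (ha.trans hsr) n).trans (ih a ha n)
  have hlink : ∀ s r, s ≤ r → ∀ a ≤ r, ∀ n ≥ r, (p r).2 a n ⊆ link c (p s).1 P := by
    intro s r hsr
    induction r, hsr using Nat.le_induction with
    | base => exact fun a ha n hn => ((hI s).1 a ha n hn).2.2
    | succ r hsr ih =>
      intro a ha n hn
      rcases Nat.le_succ_iff.1 ha with ha | rfl
      · exact ((hR r).2.1 a ha n).trans (ih a ha n (by omega))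
      · exact ((hR r).2.2 n).trans (ih _ (Nat.unpair_left_le r) r le_rfl)
  refine ⟨fun n => (p n).1, fun m n hmn => ?_, fun a ε hε => ?_⟩
  · obtain ⟨r, rfl⟩ := Nat.exists_eq_add_of_lt hmn
    exact hlink m (m + r) (by omega) _ (Nat.unpair_left_le _) _ le_rfl (hR (m + r)).1
  · obtain ⟨k, hk⟩ := exists_nat_one_div_lt hε
    have ha : a ≤ Nat.pair a k := Nat.left_le_pair a k
    have hmem := (hR (Nat.pair a k)).1
    rw [Nat.unpair_pair] at hmem
    refine ⟨Nat.pair a k + 1, (hlink a _ ha a ha _ le_rfl hmem).1, lt_trans ?_ hk⟩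
    refine (Metric.mem_ball.1 ((hI a).2.1 _ ha (hmono a _ ha a le_rfl _ hmem))).trans_le ?_
    have : (k : ℝ) ≤ (Nat.pair a k : ℕ) := by exact_mod_cast Nat.right_le_pair a k
    gcongr

/-- Corollary B (Galvin's Conjecture): for every positive `K` and colouring `c` of pairs of
reals into `K` colours, there is a set of reals `Y` homeomorphic to `ℚ` with `|c''[Y]²| ≤ 2`. -/
theorem galvin_conjecture (K : ℕ) (hK : 0 < K) (c : Sym2 ℝ → Fin K) :
    ∃ Y : Set ℝ, Nonempty (↥Y ≃ₜ ℚ) ∧ (pairColours c Y).ncard ≤ 2 := by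
  obtain ⟨s, A, hA, hfan⟩ := exists_forall_not_isMeagre_setOf_isFanPoint c
  obtain ⟨y, hlink, hlim⟩ := exists_seq_link c {s.1, s.2} hA hfan
  refine ⟨range y, ?_, ?_⟩
  · have : Countable (range y) := (countable_range y).to_subtype
    have : Nonempty (range y) := ⟨⟨y 0, 0, rfl⟩⟩
    refine nonempty_homeomorph_rat ?_
    rintro ⟨-, a, rfl⟩
    rw [← mem_closure_iff_nhdsWithin_neBot, Metric.mem_closure_iff]
    intro ε hε
    obtain ⟨n, hne, hd⟩ := hlim a ε hε
    exact ⟨⟨y n, n, rfl⟩, fun h => hne (congrArg Subtype.val h), by rwa [dist_comm]⟩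
  · refine (ncard_le_ncard ?_ (toFinite _)).trans ((ncard_insert_le s.1 {s.2}).trans (by simp))
    rintro k ⟨-, ⟨m, rfl⟩, -, ⟨n, rfl⟩, hne, rfl⟩
    rcases lt_trichotomy m n with h | rfl | h
    · exact (hlink m n h).2
    · exact absurd rfl hne
    · rw [Sym2.eq_swap]
      exact (hlink n m h).2
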